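/- For all ξ, η ∈ ℝ³: (i) Φ_{f−}(ξ,η) = 0 if and only if 2 ξ·η = −⟨η⟩ + |η|²; (ii) ∇_η Φ_{f−}(ξ,η) = 0 if and only if ξ = η·(1 − 1/(2⟨η⟩)); and (iii) there is no pair (ξ,η) ∈ ℝ³ × ℝ³ with Φ_{f−}(ξ,η) = 0 and ∇_η Φ_{f−}(ξ,η) = 0, i.e. the space-time resonant set ℛ_{f−} is empty. -/

import Mathlib

open scoped RealInnerProductSpace

noncomputable section

/-- The phase `Φ_{f−}(ξ,η) = |ξ|² + ⟨η⟩ − |ξ−η|²` with `⟨η⟩ = √(1+|η|²)`. -/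
def phiFminus (ξ η : EuclideanSpace ℝ (Fin 3)) : ℝ :=
  ‖ξ‖ ^ 2 + Real.sqrt (1 + ‖η‖ ^ 2) - ‖ξ - η‖ ^ 2

lemma hasGradientAt_phiFminus (ξ η : EuclideanSpace ℝ (Fin 3)) :
    HasGradientAt (phiFminus ξ)
      ((1 / Real.sqrt (1 + ‖η‖ ^ 2)) • η + (2 : ℝ) • (ξ - η)) η := by
  rw [hasGradientAt_iff_hasFDerivAt]
  have h1 : HasFDerivAt (fun y : EuclideanSpace ℝ (Fin 3) => 1 + ‖y‖ ^ 2) _ η :=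
    ((hasFDerivAt_id η).norm_sq).const_add 1
  have h2 := h1.sqrt (by positivity)
  have h3 : HasFDerivAt (fun y : EuclideanSpace ℝ (Fin 3) => ‖ξ - y‖ ^ 2) _ η :=
    ((hasFDerivAt_id η).const_sub ξ).norm_sq
  have h4 := (h2.const_add (‖ξ‖ ^ 2)).sub h3
  refine h4.congr_fderiv ?_
  ext v
  simp [inner_add_left, inner_sub_left, inner_smul_left]
  ring

lemma phiFminus_eq (ξ η : EuclideanSpace ℝ (Fin 3)) :
    phiFminus ξ η = 2 * ⟪ξ, η⟫ + Real.sqrt (1 + ‖η‖ ^ 2) - ‖η‖ ^ 2 := by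
  unfold phiFminus
  rw [norm_sub_sq_real]
  ring

lemma gradient_phiFminus_eq_zero (ξ η : EuclideanSpace ℝ (Fin 3)) :
    gradient (phiFminus ξ) η = 0 ↔
      ξ = (1 - 1 / (2 * Real.sqrt (1 + ‖η‖ ^ 2))) • η := by
  rw [(hasGradientAt_phiFminus ξ η).gradient]
  have hs : 0 < Real.sqrt (1 + ‖η‖ ^ 2) := Real.sqrt_pos.2 (by positivity)
  generalize Real.sqrt (1 + ‖η‖ ^ 2) = s at hs
  have key : (1 / s) • η + (2 : ℝ) • (ξ - η) = (2 : ℝ) • (ξ - (1 - 1 / (2 * s)) • η) := by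
    have : (1 / s) = 2 * (1 / (2 * s)) := by field_simp
    rw [this]
    module
  rw [key, smul_eq_zero, sub_eq_zero]
  simp

/-- (i) `Φ_{f−}(ξ,η) = 0` iff `2ξ·η = −⟨η⟩ + |η|²`; (ii) `∇_η Φ_{f−}(ξ,η) = 0` iff
`ξ = η(1 − 1/(2⟨η⟩))`; (iii) the space-time resonant set `ℛ_{f−}` is empty. -/
theorem resonant_sets_fminus :
    (∀ ξ η : EuclideanSpace ℝ (Fin 3),
        phiFminus ξ η = 0 ↔ 2 * ⟪ξ, η⟫ = -Real.sqrt (1 + ‖η‖ ^ 2) + ‖η‖ ^ 2) ∧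
    (∀ ξ η : EuclideanSpace ℝ (Fin 3),
        gradient (phiFminus ξ) η = 0 ↔
          ξ = (1 - 1 / (2 * Real.sqrt (1 + ‖η‖ ^ 2))) • η) ∧
    ¬∃ ξ η : EuclideanSpace ℝ (Fin 3),
        phiFminus ξ η = 0 ∧ gradient (phiFminus ξ) η = 0 := by
  refine ⟨fun ξ η => ?_, gradient_phiFminus_eq_zero, ?_⟩
  · rw [phiFminus_eq]
    constructor <;> intro h <;> linarith
  · rintro ⟨ξ, η, h1, h2⟩
    rw [gradient_phiFminus_eq_zero] at h2
    rw [phiFminus_eq, h2, real_inner_smul_left, real_inner_self_eq_norm_sq] at h1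
    have hs : 1 ≤ Real.sqrt (1 + ‖η‖ ^ 2) := Real.one_le_sqrt.2 (by nlinarith [sq_nonneg ‖η‖])
    generalize Real.sqrt (1 + ‖η‖ ^ 2) = s at hs h1
    have h3 : 1 / (2 * s) ≤ 1 / 2 := by
      apply one_div_le_one_div_of_le <;> linarith
    nlinarith [mul_nonneg (sub_nonneg.2 h3) (sq_nonneg ‖η‖)]
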